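/- Let ℬ be a C-s-w-semi-greedy Markushevich basis of 𝕏 (C > 0, 0 < s ≤ 1), suppose the weight w = (w_i) has a subsequence (w_{i_k})_{k∈ℕ} with inf_k w_{i_k} > 0, and suppose the corresponding subsequence (x_{i_k})_{k∈ℕ} of ℬ has the FDSP with constant M. Then for every x ∈ 𝕏, every m ∈ ℕ, every 0 < t ≤ 1, every A ∈ 𝒢(x,m,t), and every y ∈ 𝕏 with w(supp(y)) ≤ w(A) and supp(y) ∩ A = ∅, one has ‖x − P_A(x)‖ ≤ C·M·max{1 + 8t⁻¹s⁻¹λλ′, 1 + 6C·t⁻¹s⁻³}·‖x − y‖. In particular, taking t = 1, ℬ is w-almost greedy with constant C·M·max{1 + 8s⁻¹λλ′, 1 + 6Cs⁻³}. -/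

import Mathlib

open scoped BigOperators ENNReal
open Filter

noncomputable section

namespace GreedyPaper

variable {𝕜 : Type*} [RCLike 𝕜] {X : Type*} [NormedAddCommGroup X] [NormedSpace 𝕜 X]

/-- Support of `x` with respect to the coordinate functionals `f`. -/
def msupp (f : ℕ → X →L[𝕜] 𝕜) (x : X) : Set ℕ := {i | f i x ≠ 0}

/-- Projection onto a finite set of coordinates. -/
def proj (e : ℕ → X) (f : ℕ → X →L[𝕜] 𝕜) (A : Finset ℕ) (x : X) : X :=
  ∑ i ∈ A, f i x • e i

/-- `A` is an `m`-`t`-greedy set for `x`: `|A| = m` and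
`min_{j ∈ A} |f j x| ≥ t · sup_{k ∉ A} |f k x|`. -/
def GreedySet (f : ℕ → X →L[𝕜] 𝕜) (x : X) (m : ℕ) (t : ℝ) (A : Finset ℕ) : Prop :=
  A.card = m ∧ ∀ j ∈ A, ∀ k ∉ A, t * ‖f k x‖ ≤ ‖f j x‖

/-- `w`-measure of a set of indices, with value in `ℝ≥0∞` (possibly infinite). -/
def wsum (w : ℕ → ℝ) (S : Set ℕ) : ℝ≥0∞ := ∑' i : S, ENNReal.ofReal (w i)

/-- Sign of a scalar: `sgn 0 = 1` and `sgn t * t = |t|`. -/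
def sgn (t : 𝕜) : 𝕜 := if t = 0 then 1 else (‖t‖ : 𝕜) / t

/-- A Markushevich basis (with the boundedness assumptions of the paper):
biorthogonality, dense span, totality of the coordinate functionals, and boundedness
of both the basis vectors and the coordinate functionals. -/
structure IsMarkushevichBasis (e : ℕ → X) (f : ℕ → X →L[𝕜] 𝕜) : Prop where
  biorth : ∀ i j, f i (e j) = if i = j then 1 else 0
  dense_span : Dense ((Submodule.span 𝕜 (Set.range e) : Submodule 𝕜 X) : Set X)
  total : ∀ x : X, (∀ i, f i x = 0) → x = 0
  bddE : BddAbove (Set.range fun i => ‖e i‖)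
  bddF : BddAbove (Set.range fun i => ‖f i‖)

/-- `ℬ` is `C`-`s`-`w`-semi-greedy: for every `x` and `m` there are an `m`-`s`-greedy set `A`
and `y` supported in `A` with `‖x - y‖ ≤ C · inf {‖x - z‖ : supp z finite, w(supp z) ≤ w(A)}`. -/
def SemiGreedy (e : ℕ → X) (f : ℕ → X →L[𝕜] 𝕜) (w : ℕ → ℝ) (C s : ℝ) : Prop :=
  ∀ (x : X) (m : ℕ), ∃ A : Finset ℕ, GreedySet f x m s A ∧
    ∃ y : X, msupp f y ⊆ (A : Set ℕ) ∧
      ∀ z : X, (msupp f z).Finite → wsum w (msupp f z) ≤ wsum w (A : Set ℕ) →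
        ‖x - y‖ ≤ C * ‖x - z‖

/-- `ℬ` is `C`-`s`-`w`-almost semi-greedy. -/
def AlmostSemiGreedy (e : ℕ → X) (f : ℕ → X →L[𝕜] 𝕜) (w : ℕ → ℝ) (C s : ℝ) : Prop :=
  ∀ (x : X) (m : ℕ), ∃ A : Finset ℕ, GreedySet f x m s A ∧
    ∃ y : X, msupp f y ⊆ (A : Set ℕ) ∧
      ∀ B : Finset ℕ, wsum w (B : Set ℕ) ≤ wsum w (A : Set ℕ) →
        ‖x - y‖ ≤ C * ‖x - proj e f B x‖

/-- `ℬ` is `C`-`w`-almost greedy. -/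
def AlmostGreedy (e : ℕ → X) (f : ℕ → X →L[𝕜] 𝕜) (w : ℕ → ℝ) (C : ℝ) : Prop :=
  ∀ (x : X) (m : ℕ) (A : Finset ℕ), GreedySet f x m 1 A →
    ∀ B : Finset ℕ, wsum w (B : Set ℕ) ≤ wsum w (A : Set ℕ) →
      ‖x - proj e f A x‖ ≤ C * ‖x - proj e f B x‖

/-- `ℬ` is `C`-`w`-disjoint almost greedy. -/
def DisjointAlmostGreedy (e : ℕ → X) (f : ℕ → X →L[𝕜] 𝕜) (w : ℕ → ℝ) (C : ℝ) : Prop :=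
  ∀ (x : X) (m : ℕ) (A : Finset ℕ), GreedySet f x m 1 A →
    ∀ B : Finset ℕ, wsum w (B : Set ℕ) ≤ wsum w (A : Set ℕ) → Disjoint B A →
      ‖x - proj e f A x‖ ≤ C * ‖x - proj e f B x‖

/-- `ℬ` is `C`-`s`-`w`-almost greedy in the weak sense. -/
def WeakAlmostGreedy (e : ℕ → X) (f : ℕ → X →L[𝕜] 𝕜) (w : ℕ → ℝ) (C s : ℝ) : Prop :=
  ∀ (x : X) (m : ℕ), ∃ A : Finset ℕ, GreedySet f x m s A ∧
    ∀ B : Finset ℕ, wsum w (B : Set ℕ) ≤ wsum w (A : Set ℕ) →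
      ‖x - proj e f A x‖ ≤ C * ‖x - proj e f B x‖

/-- `ℬ` is `C`-`w`-superdemocratic. -/
def SuperDemocratic (e : ℕ → X) (f : ℕ → X →L[𝕜] 𝕜) (w : ℕ → ℝ) (C : ℝ) : Prop :=
  ∀ (A B : Finset ℕ) (ε ε' : ℕ → 𝕜), (∀ i ∈ A, ‖ε i‖ = 1) → (∀ i ∈ B, ‖ε' i‖ = 1) →
    wsum w (A : Set ℕ) ≤ wsum w (B : Set ℕ) →
      ‖∑ i ∈ A, ε i • e i‖ ≤ C * ‖∑ i ∈ B, ε' i • e i‖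

/-- `ℬ` is `C`-`w`-democratic. -/
def Democratic (e : ℕ → X) (f : ℕ → X →L[𝕜] 𝕜) (w : ℕ → ℝ) (C : ℝ) : Prop :=
  ∀ A B : Finset ℕ, wsum w (A : Set ℕ) ≤ wsum w (B : Set ℕ) →
    ‖∑ i ∈ A, e i‖ ≤ C * ‖∑ i ∈ B, e i‖

/-- `ℬ` is `C`-truncation quasi-greedy. -/
def TruncationQuasiGreedy (e : ℕ → X) (f : ℕ → X →L[𝕜] 𝕜) (C : ℝ) : Prop :=
  ∀ (x : X) (m : ℕ) (A : Finset ℕ) (hA : A.Nonempty), GreedySet f x m 1 A →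
    (A.inf' hA fun i => ‖f i x‖) * ‖∑ i ∈ A, sgn (f i x) • e i‖ ≤ C * ‖x‖

/-- `ℬ` has the `C`-`w`-Property (A). -/
def PropertyA (e : ℕ → X) (f : ℕ → X →L[𝕜] 𝕜) (w : ℕ → ℝ) (C : ℝ) : Prop :=
  ∀ x : X, (∀ i, ‖f i x‖ ≤ 1) →
    ∀ A B : Finset ℕ, wsum w (A : Set ℕ) ≤ wsum w (B : Set ℕ) → Disjoint A B →
      (∀ i ∈ A ∪ B, f i x = 0) →
      ∀ ε ε' : ℕ → 𝕜, (∀ i ∈ A, ‖ε i‖ = 1) → (∀ i ∈ B, ‖ε' i‖ = 1) →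
        ‖x + ∑ i ∈ A, ε i • e i‖ ≤ C * ‖x + ∑ i ∈ B, ε' i • e i‖

/-- The finite dimensional separation property (FDSP) with constant `M`. -/
def FDSP (e : ℕ → X) (M : ℝ) : Prop :=
  ∀ Z : Submodule 𝕜 X, IsClosed (Z : Set X) → TopologicalSpace.IsSeparable (Z : Set X) →
    ∀ ε : ℝ, 0 < ε → ∃ k : ℕ → ℕ, StrictMono k ∧
      (∀ (a : ℕ → 𝕜) (n l : ℕ), n ≤ l →
        ‖∑ j ∈ Finset.range (n + 1), a j • e (k j)‖ ≤
          (M + ε) * ‖∑ j ∈ Finset.range (l + 1), a j • e (k j)‖) ∧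
      (∀ F : Submodule 𝕜 X, F ≤ Z → FiniteDimensional 𝕜 F →
        ∃ N : ℕ, ∀ x ∈ F,
          ∀ z ∈ closure ((Submodule.span 𝕜 {v : X | ∃ n, N < n ∧ v = e (k n)} :
              Submodule 𝕜 X) : Set X),
            ‖x‖ ≤ (M + ε) * ‖x + z‖)

/-- `v` is a block basis of `e`. -/
def IsBlockBasis (e v : ℕ → X) : Prop :=
  ∃ (b : ℕ → 𝕜) (n m : ℕ → ℕ), (∀ i, n i ≤ m i) ∧ (∀ i, m i < n (i + 1)) ∧
    (∀ i, v i = ∑ k ∈ Finset.Icc (n i) (m i), b k • e k) ∧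
    (∀ i, ∃ k ∈ Finset.Icc (n i) (m i), b k ≠ 0)

section SemiGreedyAux

variable {e : ℕ → X} {f : ℕ → X →L[𝕜] 𝕜} {w : ℕ → ℝ}

namespace IsMarkushevichBasis

lemma coeff_sum (hb : IsMarkushevichBasis e f) (D : Finset ℕ) (a : ℕ → 𝕜) (i : ℕ) :
    f i (∑ j ∈ D, a j • e j) = if i ∈ D then a i else 0 := by
  simp [map_sum, hb.biorth, Finset.sum_ite_eq]

lemma coeff_proj (hb : IsMarkushevichBasis e f) (D : Finset ℕ) (x : X) (i : ℕ) :
    f i (proj e f D x) = if i ∈ D then f i x else 0 :=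
  hb.coeff_sum D (fun j => f j x) i

lemma eq_proj_of_msupp_subset (hb : IsMarkushevichBasis e f) {D : Finset ℕ} {y : X}
    (hy : msupp f y ⊆ (D : Set ℕ)) : y = proj e f D y := by
  refine sub_eq_zero.1 (hb.total _ fun i => ?_)
  rw [map_sub, hb.coeff_proj]
  split_ifs with hi
  · simp
  · have : f i y = 0 := by
      by_contra h
      exact hi (hy h)
    simp [this]

lemma norm_vec_le (hb : IsMarkushevichBasis e f) (i : ℕ) : ‖e i‖ ≤ ⨆ i, ‖e i‖ :=
  le_ciSup hb.bddE i

lemma norm_coeff_le (hb : IsMarkushevichBasis e f) (i : ℕ) (x : X) :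
    ‖f i x‖ ≤ (⨆ i, ‖f i‖) * ‖x‖ :=
  ((f i).le_opNorm x).trans
    (mul_le_mul_of_nonneg_right (le_ciSup hb.bddF i) (norm_nonneg x))

lemma vec_ne_zero (hb : IsMarkushevichBasis e f) (i : ℕ) : e i ≠ 0 := by
  intro h
  have := hb.biorth i i
  simp [h] at this

/-- The coordinates of a vector form a null sequence. -/
lemma exists_norm_coeff_lt (hb : IsMarkushevichBasis e f) (x : X) {δ : ℝ} (hδ : 0 < δ) :
    ∃ N : ℕ, ∀ n, N ≤ n → ‖f n x‖ < δ := by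
  set L := ⨆ i, ‖f i‖
  have hL : 0 ≤ L := (norm_nonneg _).trans (le_ciSup hb.bddF 0)
  obtain ⟨y, hy, hxy⟩ := Metric.mem_closure_iff.1 (hb.dense_span x) (δ / (L + 1)) (by positivity)
  obtain ⟨N, hN⟩ : ∃ N : ℕ, ∀ n, N ≤ n → f n y = 0 := by
    clear hxy
    induction hy using Submodule.span_induction with
    | mem y hy =>
      obtain ⟨j, rfl⟩ := hy
      refine ⟨j + 1, fun n hn => ?_⟩
      rw [hb.biorth, if_neg (by omega)]
    | zero => exact ⟨0, by simp⟩
    | add y z _ _ hy hz =>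
      obtain ⟨N₁, h₁⟩ := hy
      obtain ⟨N₂, h₂⟩ := hz
      refine ⟨max N₁ N₂, fun n hn => ?_⟩
      simp [h₁ n (le_trans (le_max_left _ _) hn), h₂ n (le_trans (le_max_right _ _) hn)]
    | smul a y _ hy =>
      obtain ⟨N₁, h₁⟩ := hy
      exact ⟨N₁, fun n hn => by simp [h₁ n hn]⟩
  refine ⟨N, fun n hn => ?_⟩
  have h1 : f n x = f n (x - y) := by simp [hN n hn]
  rw [dist_eq_norm] at hxy
  calc ‖f n x‖ ≤ L * ‖x - y‖ := h1 ▸ hb.norm_coeff_le n (x - y)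
    _ ≤ L * (δ / (L + 1)) := by gcongr
    _ < δ := by
      rw [mul_div_assoc', div_lt_iff₀ (by positivity)]
      nlinarith

lemma finite_le_norm_coeff (hb : IsMarkushevichBasis e f) (x : X) {δ : ℝ} (hδ : 0 < δ) :
    {i | δ ≤ ‖f i x‖}.Finite := by
  obtain ⟨N, hN⟩ := hb.exists_norm_coeff_lt x hδ
  refine (Set.finite_lt_nat N).subset fun i hi => ?_
  by_contra h
  exact absurd (hN i (not_lt.1 h)) (not_lt.2 hi)

lemma isSeparable_univ (hb : IsMarkushevichBasis e f) :
    TopologicalSpace.IsSeparable (Set.univ : Set X) := by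
  have h := ((Set.countable_range e).isSeparable.span (R := 𝕜)).closure
  rwa [hb.dense_span.closure_eq] at h

end IsMarkushevichBasis

lemma wsum_finset (hw : ∀ i, 0 < w i) (A : Finset ℕ) :
    wsum w (A : Set ℕ) = ENNReal.ofReal (∑ i ∈ A, w i) := by
  unfold wsum
  rw [ENNReal.ofReal_sum_of_nonneg fun i _ => (hw i).le]
  exact Finset.tsum_subtype A fun i => ENNReal.ofReal (w i)

lemma wsum_mono {S T : Set ℕ} (h : S ⊆ T) : wsum w S ≤ wsum w T :=
  ENNReal.tsum_mono_subtype (fun i => ENNReal.ofReal (w i)) h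

lemma sum_le_sum_of_wsum_le (hw : ∀ i, 0 < w i) {A B : Finset ℕ}
    (h : wsum w (B : Set ℕ) ≤ wsum w (A : Set ℕ)) : ∑ i ∈ B, w i ≤ ∑ i ∈ A, w i := by
  rw [wsum_finset hw, wsum_finset hw] at h
  exact (ENNReal.ofReal_le_ofReal_iff (Finset.sum_nonneg fun i _ => (hw i).le)).1 h

lemma wsum_le_of_sum_le (hw : ∀ i, 0 < w i) {A B : Finset ℕ}
    (h : ∑ i ∈ B, w i ≤ ∑ i ∈ A, w i) : wsum w (B : Set ℕ) ≤ wsum w (A : Set ℕ) := by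
  rw [wsum_finset hw, wsum_finset hw]
  exact ENNReal.ofReal_le_ofReal h

/-- The semi-greedy property with the weights of finite sets as real sums. -/
lemma SemiGreedy.exists_greedySet (hw : ∀ i, 0 < w i) {C s : ℝ} (h : SemiGreedy e f w C s)
    (x : X) (m : ℕ) : ∃ A : Finset ℕ, GreedySet f x m s A ∧ ∃ y : X, msupp f y ⊆ (A : Set ℕ) ∧
      ∀ (z : X) (B : Finset ℕ), msupp f z ⊆ (B : Set ℕ) → ∑ i ∈ B, w i ≤ ∑ i ∈ A, w i →
        ‖x - y‖ ≤ C * ‖x - z‖ := by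
  obtain ⟨A, hA, y, hy, hz⟩ := h x m
  exact ⟨A, hA, y, hy, fun z B hzB hB => hz z (B.finite_toSet.subset hzB)
    ((wsum_mono hzB).trans (wsum_le_of_sum_le hw hB))⟩

lemma SemiGreedy.one_le (hb : IsMarkushevichBasis e f) {C s : ℝ}
    (h : SemiGreedy e f w C s) : 1 ≤ C := by
  obtain ⟨A, hA, y, hy, hz⟩ := h (e 0) 0
  have hA0 : A = ∅ := Finset.card_eq_zero.1 hA.1
  subst hA0
  have hy0 : y = 0 := by simpa [proj] using hb.eq_proj_of_msupp_subset hy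
  have h0 : msupp f (0 : X) = ∅ := by simp [msupp]
  have := hz 0 (by simp [h0]) (by simp [h0])
  rw [hy0, sub_zero] at this
  have hpos : 0 < ‖e 0‖ := norm_pos_iff.2 (hb.vec_ne_zero 0)
  exact le_of_mul_le_mul_right (by linarith) hpos

lemma FDSP.one_le {u : ℕ → X} {M : ℝ} (h : FDSP (𝕜 := 𝕜) u M) (hu : ∀ i, u i ≠ 0) : 1 ≤ M := by
  refine le_of_forall_pos_le_add fun ε hε => ?_
  obtain ⟨k, -, hk, -⟩ := h ⊥ (by simp) (by simpa using (Set.finite_singleton (0 : X)).isSeparable)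
    ε hε
  have := hk (fun _ => 1) 0 0 le_rfl
  simp only [zero_add, Finset.sum_range_one, one_smul] at this
  have hpos : 0 < ‖u (k 0)‖ := norm_pos_iff.2 (hu _)
  exact le_of_mul_le_mul_right (by linarith) hpos

/-- If a greedy set of `v` of order `|D|` has to beat a strict gap between `D` and its complement,
it equals `D`. -/
lemma GreedySet.eq_of_gap {v : X} {s r : ℝ} {G D : Finset ℕ} (hG : GreedySet f v D.card s G)
    (hD : ∀ j ∈ D, r < s * ‖f j v‖) (hDc : ∀ k ∉ D, ‖f k v‖ ≤ r) : G = D := by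
  by_contra hne
  obtain ⟨k, hkG, hkD⟩ : ∃ k ∈ G, k ∉ D := by
    by_contra! h
    exact hne (Finset.eq_of_subset_of_card_le h hG.1.ge)
  obtain ⟨j, hjD, hjG⟩ : ∃ j ∈ D, j ∉ G := by
    by_contra! h
    exact hne (Finset.eq_of_subset_of_card_le h hG.1.le).symm
  linarith [hG.2 k hkG j hjG, hD j hjD, hDc k hkD]

/-- Adding to `u` a small multiple of the indicator of a far away set `D` which is not heavier than
a set `A` where the coordinates of `u` are large, the semi-greedy approximant is supported in a
finite set that does not depend on `D`. -/
lemma SemiGreedy.exists_approx_add_indicator (hb : IsMarkushevichBasis e f) (hw : ∀ i, 0 < w i)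
    {C s : ℝ} (hs0 : 0 < s) (hs1 : s ≤ 1) (hsg : SemiGreedy e f w C s) (u : X) {b : ℝ}
    (hb0 : 0 < b) {A : Finset ℕ} (hA : ∀ j ∈ A, b ≤ ‖f j u‖) {γ : ℝ} (hγ0 : 0 ≤ γ)
    (hγ : γ < s ^ 2 * b) :
    ∃ (H : Finset ℕ) (N : ℕ), ∀ D : Finset ℕ, (∀ i ∈ D, N ≤ i) → ∑ i ∈ D, w i ≤ ∑ i ∈ A, w i →
      ∃ Y : X, msupp f Y ⊆ (H : Set ℕ) ∧ ‖u + ∑ i ∈ D, (γ : 𝕜) • e i - Y‖ ≤ C * ‖u‖ := by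
  have hG := hb.finite_le_norm_coeff u (mul_pos hs0 hb0)
  have hH := hb.finite_le_norm_coeff u (mul_pos (pow_pos hs0 2) hb0)
  obtain ⟨N, hN⟩ := hb.exists_norm_coeff_lt u (sub_pos.2 hγ)
  have hsb : s * b ≤ b := by nlinarith
  have hssb : s ^ 2 * b ≤ s * b := by nlinarith [mul_pos hs0 hb0]
  refine ⟨hH.toFinset, N, fun D hD hDA => ?_⟩
  set v := u + ∑ i ∈ D, (γ : 𝕜) • e i with hv
  have hvD : ∀ i ∈ D, ‖f i v‖ < s ^ 2 * b := by
    intro i hi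
    rw [hv, map_add, hb.coeff_sum D (fun _ => (γ : 𝕜)), if_pos hi]
    refine (norm_add_le _ _).trans_lt ?_
    rw [RCLike.norm_ofReal, abs_of_nonneg hγ0]
    linarith [hN i (hD i hi)]
  have hvDc : ∀ i ∉ D, f i v = f i u := by
    intro i hi
    rw [hv, map_add, hb.coeff_sum D (fun _ => (γ : 𝕜)), if_neg hi, add_zero]
  have huD : ∀ i, s ^ 2 * b ≤ ‖f i u‖ → i ∉ D := fun i hi hiD => by
    linarith [hN i (hD i hiD)]
  have hvu : ∀ i, s ^ 2 * b ≤ ‖f i v‖ → ‖f i v‖ = ‖f i u‖ := fun i hi => by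
    rw [hvDc i fun hiD => absurd (hvD i hiD) (not_lt.2 hi)]
  obtain ⟨G, hGg, Y, hY, hz⟩ := hsg.exists_greedySet hw v hG.toFinset.card
  have hAG : A ⊆ G := by
    intro j hj
    by_contra hjG
    have hsub : G ⊆ hG.toFinset := by
      intro k hk
      have h1 := hGg.2 k hk j hjG
      rw [hvDc j (huD j (by linarith [hA j hj]))] at h1
      have h2 : s * b ≤ ‖f k v‖ := by nlinarith [hA j hj]
      simpa [← hvu k (hssb.trans h2)] using h2
    have := Finset.eq_of_subset_of_card_le hsub hGg.1.ge
    exact hjG (this ▸ by simpa using hsb.trans (hA j hj))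
  have hGH : G ⊆ hH.toFinset := by
    by_cases hsub : hG.toFinset ⊆ G
    · rw [← Finset.eq_of_subset_of_card_le hsub hGg.1.le]
      intro k hk
      simp only [Set.Finite.mem_toFinset, Set.mem_ofPred_eq] at hk ⊢
      exact hssb.trans hk
    · obtain ⟨g, hg, hgG⟩ := Finset.not_subset.1 hsub
      simp only [Set.Finite.mem_toFinset, Set.mem_ofPred_eq] at hg
      intro k hk
      have h1 := hGg.2 k hk g hgG
      rw [hvDc g (huD g (hssb.trans hg))] at h1
      have h2 : s ^ 2 * b ≤ ‖f k v‖ := by nlinarith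
      simpa [← hvu k h2] using h2
  refine ⟨Y, hY.trans (by exact_mod_cast hGH), ?_⟩
  have := hz (∑ i ∈ D, (γ : 𝕜) • e i) D
    (fun i hi => by
      by_contra hiD
      exact hi (by rw [hb.coeff_sum D (fun _ => (γ : 𝕜)), if_neg (by simpa using hiD)]))
    (hDA.trans (Finset.sum_le_sum_of_subset_of_nonneg hAG fun i _ _ => (hw i).le))
  rwa [hv, add_sub_cancel_right, ← hv] at this

/-- Among far away sets of bounded cardinality which are not heavier than a set `A` where the
coordinates of `u` are large, there are two successive ones whose indicators differ by at most
a multiple of `‖u‖`. -/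
lemma SemiGreedy.exists_indicator_sub_le (hb : IsMarkushevichBasis e f) (hw : ∀ i, 0 < w i)
    {C s : ℝ} (hs0 : 0 < s) (hs1 : s ≤ 1) (hsg : SemiGreedy e f w C s) (u : X) {b : ℝ}
    (hb0 : 0 < b) {A : Finset ℕ} (hA : ∀ j ∈ A, b ≤ ‖f j u‖) {γ : ℝ} (hγ0 : 0 ≤ γ)
    (hγ : γ < s ^ 2 * b) {D : ℕ → Finset ℕ} (hD : ∀ N, ∀ i ∈ D N, N ≤ i)
    (hDA : ∀ N, ∑ i ∈ D N, w i ≤ ∑ i ∈ A, w i) {K : ℝ} (hDK : ∀ N, ((D N).card : ℝ) ≤ K)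
    {η : ℝ} (hη : 0 < η) (N : ℕ) :
    ∃ n m, N ≤ n ∧ N ≤ m ∧ (∀ i ∈ D n, i < m) ∧
      γ * ‖∑ i ∈ D n, e i - ∑ i ∈ D m, e i‖ ≤ 2 * (C * ‖u‖) + η := by
  obtain ⟨H, N₁, hH⟩ := hsg.exists_approx_add_indicator hb hw hs0 hs1 u hb0 hA hγ0 hγ
  choose Y hYH hY using fun n => hH (D (n + N₁))
    (fun i hi => (Nat.le_add_left _ _).trans (hD _ i hi)) (hDA _)
  set V : Submodule 𝕜 X := Submodule.span 𝕜 (e '' (H : Set ℕ))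
  have hYV : ∀ n, Y n ∈ V := fun n => by
    rw [hb.eq_proj_of_msupp_subset (hYH n)]
    exact Submodule.sum_mem _ fun i hi =>
      V.smul_mem _ (Submodule.subset_span ⟨i, by simpa using hi, rfl⟩)
  have : FiniteDimensional 𝕜 V := FiniteDimensional.span_of_finite 𝕜 (H.finite_toSet.image e)
  have : ProperSpace V := FiniteDimensional.proper 𝕜 V
  set L := ⨆ i, ‖e i‖
  have hL : 0 ≤ L := (norm_nonneg _).trans (hb.norm_vec_le 0)
  have hbound : ∀ n, ‖Y n‖ ≤ C * ‖u‖ + (‖u‖ + K * (γ * L)) := by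
    intro n
    have h1 : ‖∑ i ∈ D (n + N₁), (γ : 𝕜) • e i‖ ≤ K * (γ * L) := by
      refine (norm_sum_le_of_le (D (n + N₁)) (f := fun i => (γ : 𝕜) • e i)
        (n := fun _ => γ * L) fun i _ => ?_).trans ?_
      · rw [norm_smul, RCLike.norm_ofReal, abs_of_nonneg hγ0]
        exact mul_le_mul_of_nonneg_left (hb.norm_vec_le i) hγ0
      · rw [Finset.sum_const, nsmul_eq_mul]
        exact mul_le_mul_of_nonneg_right (hDK _) (by positivity)
    have h2 := norm_sub_norm_le (Y n) (u + ∑ i ∈ D (n + N₁), (γ : 𝕜) • e i)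
    rw [norm_sub_rev] at h2
    linarith [hY n, norm_add_le u (∑ i ∈ D (n + N₁), (γ : 𝕜) • e i)]
  obtain ⟨a, -, φ, hφ, hlim⟩ := tendsto_subseq_of_bounded
    (Metric.isBounded_closedBall (x := (0 : V))) (x := fun n => (⟨Y n, hYV n⟩ : V))
    (fun n => by simpa using hbound n)
  obtain ⟨p, hp⟩ := Metric.cauchySeq_iff.1 hlim.cauchySeq η hη
  set n := φ (max N p)
  obtain ⟨q, hq⟩ : ∃ q, ∀ i ∈ D (n + N₁), i < q :=
    ⟨(D (n + N₁)).sup id + 1, fun i hi => Nat.lt_succ_of_le (Finset.le_sup (f := id) hi)⟩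
  set m := φ (max (max N q) p)
  have hmq : max N q ≤ m := (le_max_left _ _).trans (hφ.le_apply)
  refine ⟨n + N₁, m + N₁, ?_, ?_, fun i hi => ?_, ?_⟩
  · exact ((le_max_left N p).trans hφ.le_apply).trans (Nat.le_add_right _ _)
  · exact ((le_max_left N q).trans hmq).trans (Nat.le_add_right _ _)
  · exact (hq i hi).trans_le (((le_max_right N q).trans hmq).trans (Nat.le_add_right _ _))
  · have hYY : ‖Y n - Y m‖ < η := by
      have := hp (max N p) (le_max_right _ _) (max (max N q) p) (le_max_right _ _)
      rwa [Subtype.dist_eq, dist_eq_norm] at this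
    have hn := hY n
    have hm := hY m
    rw [← Finset.smul_sum] at hn hm
    have key : (γ : 𝕜) • (∑ i ∈ D (n + N₁), e i - ∑ i ∈ D (m + N₁), e i) =
        (u + (γ : 𝕜) • ∑ i ∈ D (n + N₁), e i - Y n)
          - (u + (γ : 𝕜) • ∑ i ∈ D (m + N₁), e i - Y m) + (Y n - Y m) := by
      rw [smul_sub]; abel
    have h3 : γ * ‖∑ i ∈ D (n + N₁), e i - ∑ i ∈ D (m + N₁), e i‖ =
        ‖(γ : 𝕜) • (∑ i ∈ D (n + N₁), e i - ∑ i ∈ D (m + N₁), e i)‖ := by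
      rw [norm_smul, RCLike.norm_ofReal, abs_of_nonneg hγ0]
    rw [h3, key]
    refine (norm_add_le _ _).trans ?_
    linarith [norm_sub_le (u + (γ : 𝕜) • ∑ i ∈ D (n + N₁), e i - Y n)
      (u + (γ : 𝕜) • ∑ i ∈ D (m + N₁), e i - Y m)]

/-- Arbitrarily far along `σ` there are finite sets of weight at least `W` with a signed
indicator of norm at most `R`. -/
def HasFarIndicators (𝕜 : Type*) [RCLike 𝕜] {X : Type*} [NormedAddCommGroup X] [NormedSpace 𝕜 X]
    (e : ℕ → X) (w : ℕ → ℝ) (σ : ℕ → ℕ) (W R : ℝ) : Prop :=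
  ∀ N : ℕ, ∃ (P : Finset ℕ) (ε : ℕ → 𝕜), (∀ i ∈ P, ∃ n, N < n ∧ i = σ n) ∧ (∀ i, ‖ε i‖ = 1) ∧
    W ≤ ∑ i ∈ P, w i ∧ ‖∑ i ∈ P, ε i • e i‖ ≤ R

lemma sum_union_ite_smul {P Q : Finset ℕ} (h : Disjoint P Q) (ε δ : ℕ → 𝕜) :
    ∑ i ∈ P ∪ Q, (if i ∈ P then ε i else δ i) • e i
      = ∑ i ∈ P, ε i • e i + ∑ i ∈ Q, δ i • e i := by
  rw [Finset.sum_union h]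
  congr 1
  · exact Finset.sum_congr rfl fun i hi => by rw [if_pos hi]
  · exact Finset.sum_congr rfl fun i hi => by rw [if_neg (Finset.disjoint_right.1 h hi)]

lemma HasFarIndicators.double {σ : ℕ → ℕ} (hσ : StrictMono σ) {W R : ℝ}
    (h : HasFarIndicators 𝕜 e w σ W R) : HasFarIndicators 𝕜 e w σ (2 * W) (2 * R) := by
  intro N
  obtain ⟨P, ε, hP, hε, hPW, hPR⟩ := h N
  obtain ⟨Q, δ, hQ, hδ, hQW, hQR⟩ := h (max N (P.sup id))
  have hdisj : Disjoint P Q := by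
    refine Finset.disjoint_left.2 fun i hiP hiQ => ?_
    obtain ⟨n, hn, rfl⟩ := hQ i hiQ
    have h1 : σ n ≤ P.sup id := Finset.le_sup (f := id) hiP
    have h2 : n ≤ σ n := hσ.le_apply
    have h3 := (le_max_right N (P.sup id)).trans_lt hn
    omega
  refine ⟨P ∪ Q, fun i => if i ∈ P then ε i else δ i, fun i hi => ?_, fun i => ?_, ?_, ?_⟩
  · rcases Finset.mem_union.1 hi with hi | hi
    · exact hP i hi
    · obtain ⟨n, hn, rfl⟩ := hQ i hi
      exact ⟨n, (le_max_left _ _).trans_lt hn, rfl⟩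
  · dsimp only
    split_ifs
    exacts [hε i, hδ i]
  · rw [Finset.sum_union hdisj]
    linarith
  · rw [sum_union_ite_smul hdisj]
    exact (norm_add_le _ _).trans (by linarith)

/-- If the weights along `σ` are between `c > 0` and `W / 2` from some point on, then there are far
away blocks with weight between `W / 2` and `W`. -/
lemma exists_block_sum_weight_mem_Icc {σ : ℕ → ℕ} (hσ : StrictMono σ) {c W : ℝ} (hc : 0 < c)
    (hcw : ∀ n, c ≤ w (σ n)) (hW : 0 < W) {N : ℕ} (hN : ∀ n, N < n → w (σ n) < W / 2) :
    ∃ D : Finset ℕ, (∀ i ∈ D, ∃ n, N < n ∧ i = σ n) ∧ W / 2 ≤ ∑ i ∈ D, w i ∧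
      ∑ i ∈ D, w i ≤ W := by
  classical
  have hex : ∃ p : ℕ, W / 2 ≤ ∑ n ∈ Finset.range p, w (σ (N + 1 + n)) := by
    obtain ⟨p, hp⟩ := exists_nat_ge (W / 2 / c)
    refine ⟨p, ((div_le_iff₀ hc).1 hp).trans ?_⟩
    simpa using Finset.card_nsmul_le_sum (Finset.range p) (fun n => w (σ (N + 1 + n))) c
      fun n _ => hcw _
  have hinj : Function.Injective fun n => σ (N + 1 + n) :=
    hσ.injective.comp (add_right_injective (N + 1))
  have hsum : ∀ p, ∑ i ∈ (Finset.range p).image fun n => σ (N + 1 + n), w i =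
      ∑ n ∈ Finset.range p, w (σ (N + 1 + n)) := fun p => Finset.sum_image hinj.injOn
  refine ⟨(Finset.range (Nat.find hex)).image fun n => σ (N + 1 + n), fun i hi => ?_, ?_, ?_⟩
  · obtain ⟨n, -, rfl⟩ := Finset.mem_image.1 hi
    exact ⟨N + 1 + n, by omega, rfl⟩
  · rw [hsum]
    exact Nat.find_spec hex
  · rw [hsum]
    obtain ⟨q, hq⟩ : ∃ q, Nat.find hex = q + 1 := by
      refine Nat.exists_eq_succ_of_ne_zero fun h0 => ?_
      have := Nat.find_spec hex
      rw [h0] at this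
      simp at this
      linarith
    have h1 := Nat.find_min hex (show q < Nat.find hex by omega)
    rw [hq, Finset.sum_range_succ]
    linarith [hN (N + 1 + q) (by omega)]

/-- If the coordinates of `u` are at least `b` in modulus on `A`, then there are far away signed
indicators, twice as heavy as `A`, whose norms are controlled by `‖u‖ / b`. -/
lemma SemiGreedy.hasFarIndicators (hb : IsMarkushevichBasis e f) (hw : ∀ i, 0 < w i)
    {C s : ℝ} (hC : 0 < C) (hs0 : 0 < s) (hs1 : s ≤ 1) (hsg : SemiGreedy e f w C s)
    {σ : ℕ → ℕ} (hσ : StrictMono σ) {c : ℝ} (hc : 0 < c) (hcw : ∀ n, c ≤ w (σ n)) (u : X) {b : ℝ}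
    (hb0 : 0 < b) {A : Finset ℕ} (hAne : A.Nonempty) (hA : ∀ j ∈ A, b ≤ ‖f j u‖) :
    HasFarIndicators 𝕜 e w σ (2 * ∑ i ∈ A, w i)
      (max (4 * ((⨆ i, ‖e i‖) * (⨆ i, ‖f i‖))) (5 * C * s⁻¹ ^ 2) * ‖u‖ / b) := by
  set W := ∑ i ∈ A, w i
  have hW : 0 < W := Finset.sum_pos (fun i _ => hw i) hAne
  set L := ⨆ i, ‖e i‖
  set L' := ⨆ i, ‖f i‖
  have hL : 0 ≤ L := (norm_nonneg _).trans (hb.norm_vec_le 0)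
  have mono : ∀ {R R' : ℝ}, R ≤ R' → HasFarIndicators 𝕜 e w σ (2 * W) R →
      HasFarIndicators 𝕜 e w σ (2 * W) R' := fun hR h N => by
    obtain ⟨P, ε, h1, h2, h3, h4⟩ := h N
    exact ⟨P, ε, h1, h2, h3, h4.trans hR⟩
  obtain ⟨j₀, hj₀⟩ := hAne
  have hbu : b ≤ L' * ‖u‖ := (hA j₀ hj₀).trans (hb.norm_coeff_le j₀ u)
  by_cases hcase : ∀ N, ∃ n, N < n ∧ W / 2 ≤ w (σ n)
  · have h1 : HasFarIndicators 𝕜 e w σ (W / 2) L := fun N => by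
      obtain ⟨n, hn, hwn⟩ := hcase N
      exact ⟨{σ n}, fun _ => 1, fun i hi => ⟨n, hn, by simpa using hi⟩, by simp, by simpa using hwn,
        by simpa using hb.norm_vec_le (σ n)⟩
    have h2 := (h1.double hσ).double hσ
    rw [show 2 * (2 * (W / 2)) = 2 * W by ring] at h2
    refine mono ?_ h2
    rw [le_div_iff₀ hb0]
    calc 2 * (2 * L) * b ≤ 2 * (2 * L) * (L' * ‖u‖) := by gcongr
      _ = 4 * (L * L') * ‖u‖ := by ring
      _ ≤ _ := by gcongr; exact le_max_left _ _
  · push Not at hcase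
    obtain ⟨N₀, hN₀⟩ := hcase
    have hu : 0 < ‖u‖ := by
      refine lt_of_le_of_ne (norm_nonneg u) fun h => ?_
      rw [← h, mul_zero] at hbu
      linarith
    choose D hDσ hDlow hDup using fun N => exists_block_sum_weight_mem_Icc hσ hc hcw hW
      (N := N + N₀) (fun n hn => hN₀ n (by omega))
    have hDcard : ∀ N, ((D N).card : ℝ) ≤ W / c := fun N => by
      rw [le_div_iff₀ hc, ← nsmul_eq_mul]
      refine (Finset.card_nsmul_le_sum (D N) w c fun i hi => ?_).trans (hDup N)
      obtain ⟨n, -, rfl⟩ := hDσ N i hi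
      exact hcw n
    have hDge : ∀ N, ∀ i ∈ D N, N ≤ i := fun N i hi => by
      obtain ⟨n, hn, rfl⟩ := hDσ N i hi
      have : n ≤ σ n := hσ.le_apply
      omega
    have h1 : HasFarIndicators 𝕜 e w σ W (5 / 2 * C * s⁻¹ ^ 2 * ‖u‖ / b) := fun N => by
      have hsb : 0 < s ^ 2 * b := by positivity
      obtain ⟨n, m, hn, hm, hnm, hle⟩ := hsg.exists_indicator_sub_le hb hw hs0 hs1 u hb0 hA
        (γ := 9 / 10 * (s ^ 2 * b)) (by positivity) (by linarith) hDge hDup hDcard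
        (η := C * ‖u‖ / 4) (by positivity) N
      have hdisj : Disjoint (D n) (D m) := Finset.disjoint_left.2 fun i hi hi' =>
        absurd (hnm i hi) (not_lt.2 (hDge m i hi'))
      refine ⟨D n ∪ D m, fun i => if i ∈ D n then 1 else -1, fun i hi => ?_, fun i => ?_, ?_, ?_⟩
      · rcases Finset.mem_union.1 hi with hi | hi
        · obtain ⟨k, hk, rfl⟩ := hDσ n i hi
          exact ⟨k, by omega, rfl⟩
        · obtain ⟨k, hk, rfl⟩ := hDσ m i hi
          exact ⟨k, by omega, rfl⟩
      · dsimp only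
        split_ifs <;> simp
      · rw [Finset.sum_union hdisj]
        linarith [hDlow n, hDlow m]
      · rw [sum_union_ite_smul hdisj (fun _ => (1 : 𝕜)) (fun _ => -1)]
        simp only [one_smul, neg_smul, Finset.sum_neg_distrib, ← sub_eq_add_neg]
        have : 5 / 2 * C * s⁻¹ ^ 2 * ‖u‖ / b = 5 / 2 * (C * ‖u‖) / (s ^ 2 * b) := by field_simp
        rw [this, le_div_iff₀ hsb]
        nlinarith [mul_pos hC hu]
    refine mono ?_ (h1.double hσ)
    have : 2 * (5 / 2 * C * s⁻¹ ^ 2 * ‖u‖ / b) = 5 * C * s⁻¹ ^ 2 * ‖u‖ / b := by ring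
    rw [this]
    gcongr
    exact le_max_right _ _

/-- The separation property applied to single vectors of the whole space. -/
lemma FDSP.exists_subseq (hb : IsMarkushevichBasis e f) {idx : ℕ → ℕ} (hidx : StrictMono idx)
    {M : ℝ} (h : FDSP (𝕜 := 𝕜) (fun k => e (idx k)) M) {ε : ℝ} (hε : 0 < ε) :
    ∃ σ : ℕ → ℕ, StrictMono σ ∧ (∀ n, ∃ k, σ n = idx k) ∧ ∀ x : X, ∃ N, ∀ D : Finset ℕ,
      (∀ i ∈ D, ∃ n, N < n ∧ i = σ n) → ∀ a : ℕ → 𝕜,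
        ‖x‖ ≤ (M + ε) * ‖x + ∑ i ∈ D, a i • e i‖ := by
  obtain ⟨k, hk, -, hsep⟩ := h ⊤ (by simp) (by simpa using hb.isSeparable_univ) ε hε
  refine ⟨fun n => idx (k n), hidx.comp hk, fun n => ⟨k n, rfl⟩, fun x => ?_⟩
  obtain ⟨N, hN⟩ := hsep (Submodule.span 𝕜 {x}) le_top inferInstance
  refine ⟨N, fun D hD a => hN x (Submodule.mem_span_singleton_self x) _ (subset_closure ?_)⟩
  refine Submodule.sum_mem _ fun i hi => Submodule.smul_mem _ _ (Submodule.subset_span ?_)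
  obtain ⟨n, hn, rfl⟩ := hD i hi
  exact ⟨n, hn, rfl⟩

/-- Vectors with small coordinates supported in a set of bounded weight are bounded. -/
lemma SemiGreedy.exists_norm_sum_le (hb : IsMarkushevichBasis e f) (hw : ∀ i, 0 < w i)
    {C s : ℝ} (hC : 0 < C) (hs0 : 0 < s) (hsg : SemiGreedy e f w C s)
    {idx : ℕ → ℕ} (hidx : StrictMono idx) {c : ℝ} (hc : 0 < c) (hcw : ∀ k, c ≤ w (idx k)) {M : ℝ}
    (hfdsp : FDSP (𝕜 := 𝕜) (fun k => e (idx k)) M) (W : ℝ) :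
    ∃ K : ℝ, ∀ (B : Finset ℕ) (a : ℕ → 𝕜), ∑ i ∈ B, w i ≤ W → (∀ i ∈ B, ‖a i‖ ≤ s / 2) →
      ‖∑ i ∈ B, a i • e i‖ ≤ K := by
  have hM : 1 ≤ M := hfdsp.one_le fun i => hb.vec_ne_zero _
  obtain ⟨σ, hσ, hσidx, hsep⟩ := hfdsp.exists_subseq hb hidx one_pos
  obtain ⟨p, hp⟩ := exists_nat_ge (W / c)
  refine ⟨(M + 1) * (C * (p * ⨆ i, ‖e i‖)), fun B a hB ha => ?_⟩
  set x := ∑ i ∈ B, a i • e i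
  obtain ⟨N, hN⟩ := hsep x
  set q := max N (B.sup id)
  have hinj : Function.Injective fun n => σ (q + 1 + n) :=
    hσ.injective.comp (add_right_injective (q + 1))
  set E := (Finset.range p).image fun n => σ (q + 1 + n)
  have hEcard : E.card = p := by
    rw [Finset.card_image_of_injective _ hinj, Finset.card_range]
  have hEσ : ∀ i ∈ E, ∃ n, q < n ∧ i = σ n := fun i hi => by
    obtain ⟨n, -, rfl⟩ := Finset.mem_image.1 hi
    exact ⟨q + 1 + n, by omega, rfl⟩
  have hEB : ∀ i ∈ E, i ∉ B := fun i hi hiB => by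
    obtain ⟨n, hn, rfl⟩ := hEσ i hi
    have h1 : σ n ≤ B.sup id := Finset.le_sup (f := id) hiB
    have h2 : n ≤ σ n := hσ.le_apply
    have h3 := (le_max_right N (B.sup id)).trans_lt hn
    omega
  have hEw : W ≤ ∑ i ∈ E, w i := by
    have : (E.card : ℝ) * c ≤ ∑ i ∈ E, w i := by
      rw [← nsmul_eq_mul]
      refine Finset.card_nsmul_le_sum E w c fun i hi => ?_
      obtain ⟨n, -, rfl⟩ := hEσ i hi
      obtain ⟨k, hk⟩ := hσidx n
      exact hk ▸ hcw k
    rw [hEcard] at this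
    exact ((div_le_iff₀ hc).1 hp).trans this
  set v := x + ∑ i ∈ E, (1 : 𝕜) • e i with hv
  have hfv : ∀ i, f i v = (if i ∈ B then a i else 0) + (if i ∈ E then 1 else 0) := fun i => by
    rw [hv, map_add, hb.coeff_sum, hb.coeff_sum E fun _ => 1]
  obtain ⟨G, hG, Y, hY, hz⟩ := hsg.exists_greedySet hw v E.card
  have hGE : G = E := by
    refine hG.eq_of_gap (r := s / 2) (fun j hj => ?_) fun j hj => ?_
    · rw [hfv, if_neg (hEB j hj), if_pos hj]
      simpa using hs0
    · rw [hfv, if_neg hj]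
      split_ifs with hjB
      · simpa using ha j hjB
      · simpa using (half_pos hs0).le
  rw [hGE] at hY hz
  have hle := hz x B (fun i hi => by
    by_contra hiB
    exact hi (by rw [hb.coeff_sum, if_neg (by simpa using hiB)])) (hB.trans hEw)
  have hvY : v - Y = x + ∑ i ∈ E, (1 - f i Y) • e i := by
    conv_lhs => rw [hb.eq_proj_of_msupp_subset hY]
    simp only [hv, proj, sub_smul, Finset.sum_sub_distrib]
    abel
  have hvx : ‖v - x‖ ≤ p * ⨆ i, ‖e i‖ := by
    rw [hv, add_sub_cancel_left, ← hEcard, ← nsmul_eq_mul, ← Finset.sum_const]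
    exact norm_sum_le_of_le _ fun i _ => by simpa using hb.norm_vec_le i
  calc ‖x‖ ≤ (M + 1) * ‖x + ∑ i ∈ E, (1 - f i Y) • e i‖ := hN E (fun i hi => by
        obtain ⟨n, hn, rfl⟩ := hEσ i hi
        exact ⟨n, (le_max_left _ _).trans_lt hn, rfl⟩) _
    _ ≤ (M + 1) * (C * (p * ⨆ i, ‖e i‖)) := by
      rw [← hvY]
      gcongr
      exact hle.trans (by gcongr)

/-- A vector whose support has finite weight is the limit of its coordinate projections. -/
lemma SemiGreedy.hasSum_of_wsum_le [CompleteSpace X] (hb : IsMarkushevichBasis e f)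
    (hw : ∀ i, 0 < w i) {C s : ℝ} (hC : 0 < C) (hs0 : 0 < s) (hsg : SemiGreedy e f w C s)
    {idx : ℕ → ℕ} (hidx : StrictMono idx) {c : ℝ} (hc : 0 < c) (hcw : ∀ k, c ≤ w (idx k)) {M : ℝ}
    (hfdsp : FDSP (𝕜 := 𝕜) (fun k => e (idx k)) M) {y : X} {A : Finset ℕ}
    (hy : wsum w (msupp f y) ≤ wsum w (A : Set ℕ)) : HasSum (fun i => f i y • e i) y := by
  classical
  obtain ⟨K, hK⟩ := hsg.exists_norm_sum_le hb hw hC hs0 hidx hc hcw hfdsp (∑ i ∈ A, w i)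
  have hK0 : 0 ≤ K := by
    simpa using hK ∅ 0 (by simpa using Finset.sum_nonneg fun i _ => (hw i).le) (by simp)
  have hsum : Summable fun i => f i y • e i := by
    refine summable_iff_vanishing_norm.2 fun η hη => ?_
    obtain ⟨N, hN⟩ := hb.exists_norm_coeff_lt y (δ := s / 2 * (η / (K + 1))) (by positivity)
    refine ⟨Finset.range N, fun T hT => ?_⟩
    set B := T.filter fun i => f i y ≠ 0
    have hBT : ∑ i ∈ T, f i y • e i = ∑ i ∈ B, f i y • e i := by
      refine (Finset.sum_filter_of_ne fun i _ hi => ?_).symm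
      exact fun h => hi (by simp [h])
    have hBw : ∑ i ∈ B, w i ≤ ∑ i ∈ A, w i :=
      sum_le_sum_of_wsum_le hw ((wsum_mono fun i hi => by
        exact (Finset.mem_filter.1 (Finset.mem_coe.1 hi)).2).trans hy)
    set r : ℝ := (K + 1) / η with hr
    have hr0 : 0 < r := by positivity
    have := hK B (fun i => (r : 𝕜) * f i y) hBw fun i hi => by
      have hiN : N ≤ i := by
        by_contra h
        exact Finset.disjoint_left.1 hT (Finset.mem_filter.1 hi).1
          (Finset.mem_range.2 (not_le.1 h))
      rw [norm_mul, RCLike.norm_ofReal, abs_of_pos hr0]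
      calc r * ‖f i y‖ ≤ r * (s / 2 * (η / (K + 1))) := by gcongr; exact (hN i hiN).le
        _ = s / 2 := by rw [hr]; field_simp
    simp only [mul_smul, ← Finset.smul_sum] at this
    rw [norm_smul, RCLike.norm_ofReal, abs_of_pos hr0, hr, div_mul_eq_mul_div,
      div_le_iff₀ hη] at this
    rw [hBT]
    by_contra! hcon
    nlinarith
  obtain ⟨y', hy'⟩ := hsum
  have : y' = y := by
    refine sub_eq_zero.1 (hb.total _ fun i => ?_)
    have h1 := hy'.mapL (f i)
    have h2 : HasSum (fun j => f i (f j y • e j)) (f i y) := by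
      convert hasSum_ite_eq i (f i y) using 2 with j
      rw [map_smul, hb.biorth]
      by_cases hij : j = i
      · simp [hij]
      · simp [hij, Ne.symm hij]
    rw [map_sub, h1.unique h2, sub_self]
  exact this ▸ hy'

/-- The main estimate for competitors with finite support. -/
lemma SemiGreedy.norm_sub_proj_le_of_msupp_subset (hb : IsMarkushevichBasis e f)
    (hw : ∀ i, 0 < w i) {C s : ℝ} (hC : 0 < C) (hs0 : 0 < s) (hs1 : s ≤ 1)
    (hsg : SemiGreedy e f w C s) {idx : ℕ → ℕ} (hidx : StrictMono idx) {c : ℝ} (hc : 0 < c)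
    (hcw : ∀ k, c ≤ w (idx k)) {M : ℝ} (hfdsp : FDSP (𝕜 := 𝕜) (fun k => e (idx k)) M)
    {x : X} {m : ℕ} {t : ℝ} (ht0 : 0 < t) {A B : Finset ℕ} (hA : GreedySet f x m t A) {y : X}
    (hyB : msupp f y ⊆ (B : Set ℕ)) (hBA : ∑ i ∈ B, w i ≤ ∑ i ∈ A, w i) (hdisj : Disjoint B A) :
    ‖x - proj e f A x‖ ≤
      C * M * max (1 + 8 * t⁻¹ * s⁻¹ * ((⨆ i, ‖e i‖) * (⨆ i, ‖f i‖)))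
        (1 + 6 * C * t⁻¹ * s⁻¹ ^ 3) * ‖x - y‖ := by
  classical
  have hM : 1 ≤ M := hfdsp.one_le fun i => hb.vec_ne_zero _
  have hC1 : 1 ≤ C := hsg.one_le hb
  set L := ⨆ i, ‖e i‖
  set L' := ⨆ i, ‖f i‖
  have hL : 0 ≤ L := (norm_nonneg _).trans (hb.norm_vec_le 0)
  have hL' : 0 ≤ L' := (norm_nonneg _).trans (le_ciSup hb.bddF 0)
  set Q := max (1 + 8 * t⁻¹ * s⁻¹ * (L * L')) (1 + 6 * C * t⁻¹ * s⁻¹ ^ 3)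
  have hQ1 : 1 ≤ Q := le_max_of_le_left (le_add_of_nonneg_right (by positivity))
  rcases A.eq_empty_or_nonempty with rfl | hAne
  · have hB : B = ∅ := by
      by_contra hB
      have := Finset.sum_pos (fun i _ => hw i) (Finset.nonempty_iff_ne_empty.2 hB)
      simp at hBA
      linarith
    subst hB
    have hy0 : y = 0 := by simpa [proj] using hb.eq_proj_of_msupp_subset hyB
    have : 1 ≤ C * M * Q := one_le_mul_of_one_le_of_one_le
      (one_le_mul_of_one_le_of_one_le hC1 hM) hQ1
    simpa [proj, hy0] using le_mul_of_one_le_left (norm_nonneg x) this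
  obtain ⟨j₀, hj₀, hmin⟩ := A.exists_min_image (fun j => ‖f j x‖) hAne
  obtain ⟨b, hbx⟩ : ∃ b, b = ‖f j₀ x‖ := ⟨_, rfl⟩
  rw [← hbx] at hmin
  have hout : ∀ k ∉ A, ‖f k x‖ ≤ t⁻¹ * b := fun k hk => by
    rw [← div_eq_inv_mul, le_div_iff₀ ht0, mul_comm, hbx]
    exact hA.2 j₀ hj₀ k hk
  have hfx : ∀ i, f i (x - proj e f A x) = if i ∈ A then 0 else f i x := fun i => by
    rw [map_sub, hb.coeff_proj]
    split_ifs <;> simp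
  rcases (hbx ▸ norm_nonneg _ : 0 ≤ b).eq_or_lt with hb0 | hb0
  · have : x - proj e f A x = 0 := hb.total _ fun i => by
      rw [hfx]
      split_ifs with hi
      · rfl
      · have := hout i hi
        rw [← hb0, mul_zero] at this
        exact norm_le_zero_iff.1 this
    rw [this, norm_zero]
    have : 0 ≤ C * M * Q := by positivity
    positivity
  have hyA : ∀ j ∈ A, f j y = 0 := fun j hj => by
    by_contra h
    exact Finset.disjoint_left.1 hdisj (by simpa using hyB h) hj
  have hu : ∀ j ∈ A, b ≤ ‖f j (x - y)‖ := fun j hj => by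
    rw [map_sub, hyA j hj, sub_zero]
    exact hmin j hj
  suffices h : ∀ ε > 0, ‖x - proj e f A x‖ ≤ (M + ε) * (C * (Q * ‖x - y‖)) by
    have hlim : Tendsto (fun ε : ℝ => (M + ε) * (C * (Q * ‖x - y‖))) (nhdsWithin 0 (Set.Ioi 0))
        (nhds ((M + 0) * (C * (Q * ‖x - y‖)))) :=
      (Continuous.tendsto (by fun_prop) 0).mono_left nhdsWithin_le_nhds
    refine (ge_of_tendsto hlim (eventually_mem_nhdsWithin.mono fun ε hε => h ε hε)).trans
      (le_of_eq (by ring))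
  intro ε hε
  obtain ⟨σ, hσ, hσidx, hsep⟩ := hfdsp.exists_subseq hb hidx hε
  have hcσ : ∀ n, c ≤ w (σ n) := fun n => by
    obtain ⟨k, hk⟩ := hσidx n
    exact hk ▸ hcw k
  obtain ⟨N₁, hN₁⟩ := hsep (x - proj e f A x)
  set β := s⁻¹ * (t⁻¹ * b) with hβ
  have hβ0 : 0 < β := by positivity
  obtain ⟨N₂, hN₂⟩ := hb.exists_norm_coeff_lt x (δ := β / 10) (by positivity)
  obtain ⟨D, θ, hD, hθ, hDw, hDn⟩ := hsg.hasFarIndicators hb hw hC hs0 hs1 hσ hc hcσ (x - y)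
    hb0 hAne hu (max N₁ (max N₂ (A.sup id)))
  have hDge : ∀ i ∈ D, N₂ ≤ i ∧ A.sup id < i := fun i hi => by
    obtain ⟨n, hn, rfl⟩ := hD i hi
    have h1 : n ≤ σ n := hσ.le_apply
    simp only [max_lt_iff] at hn
    omega
  have hDA : ∀ i ∈ D, i ∉ A := fun i hi hiA =>
    absurd (Finset.le_sup (f := id) hiA) (not_le.2 (hDge i hi).2)
  set α : ℝ := 11 / 10 * β with hα
  have hα0 : 0 < α := by positivity
  set v := x - proj e f A x + ∑ i ∈ D, ((α : 𝕜) * θ i) • e i with hv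
  have hfv : ∀ i, f i v = (if i ∈ A then 0 else f i x) + if i ∈ D then (α : 𝕜) * θ i else 0 :=
    fun i => by rw [hv, map_add, hfx, hb.coeff_sum D fun i => (α : 𝕜) * θ i]
  obtain ⟨G, hG, Y, hY, hz⟩ := hsg.exists_greedySet hw v D.card
  have hGD : G = D := by
    refine hG.eq_of_gap (r := t⁻¹ * b) (fun j hj => ?_) fun k hk => ?_
    · rw [hfv, if_neg (hDA j hj), if_pos hj, ← div_lt_iff₀' hs0, div_eq_inv_mul, ← hβ]
      have h1 : ‖(α : 𝕜) * θ j‖ = α := by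
        rw [norm_mul, hθ, RCLike.norm_ofReal, abs_of_pos hα0, mul_one]
      have h2 := norm_sub_le (f j x + (α : 𝕜) * θ j) (f j x)
      rw [add_sub_cancel_left, h1] at h2
      linarith [hN₂ j (hDge j hj).1]
    · rw [hfv, if_neg hk, add_zero]
      split_ifs with hkA
      · rw [norm_zero]; positivity
      · exact hout k hkA
  subst hGD
  have hle := hz (y - proj e f A x) (B ∪ A) (fun i hi => by
      by_contra hiBA
      simp only [Finset.coe_union, Set.mem_union, Finset.mem_coe, not_or] at hiBA
      have hyi : f i y = 0 := by
        by_contra h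
        exact hiBA.1 (by simpa using hyB h)
      exact hi (by rw [map_sub, hb.coeff_proj, if_neg hiBA.2, hyi, sub_zero]))
    (by rw [Finset.sum_union hdisj]; linarith)
  have hvz : v - (y - proj e f A x) = (x - y) + ∑ i ∈ G, ((α : 𝕜) * θ i) • e i := by
    rw [hv]; abel
  have hvY : v - Y = x - proj e f A x + ∑ i ∈ G, ((α : 𝕜) * θ i - f i Y) • e i := by
    conv_lhs => rw [hb.eq_proj_of_msupp_subset hY]
    simp only [hv, sub_smul, Finset.sum_sub_distrib]
    rw [show proj e f G Y = ∑ i ∈ G, f i Y • e i from rfl]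
    abel
  have hind : ‖∑ i ∈ G, ((α : 𝕜) * θ i) • e i‖ ≤ (Q - 1) * ‖x - y‖ := by
    simp only [mul_smul, ← Finset.smul_sum]
    rw [norm_smul, RCLike.norm_ofReal, abs_of_pos hα0]
    refine (mul_le_mul_of_nonneg_left hDn hα0.le).trans ?_
    have h1 : α * (max (4 * (L * L')) (5 * C * s⁻¹ ^ 2) * ‖x - y‖ / b) =
        (11 / 10 * (s⁻¹ * t⁻¹) * max (4 * (L * L')) (5 * C * s⁻¹ ^ 2)) * ‖x - y‖ := by
      rw [hα, hβ]; field_simp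
    rw [h1]
    refine mul_le_mul_of_nonneg_right ?_ (norm_nonneg _)
    rw [mul_max_of_nonneg _ _ (by positivity)]
    refine max_le ?_ ?_
    · have h2 : 1 + 8 * t⁻¹ * s⁻¹ * (L * L') ≤ Q := le_max_left _ _
      have h3 : 0 ≤ t⁻¹ * s⁻¹ * (L * L') := by positivity
      linarith
    · have h2 : 1 + 6 * C * t⁻¹ * s⁻¹ ^ 3 ≤ Q := le_max_right _ _
      have h3 : 0 ≤ C * t⁻¹ * s⁻¹ ^ 3 := by positivity
      linarith
  calc ‖x - proj e f A x‖
      ≤ (M + ε) * ‖x - proj e f A x + ∑ i ∈ G, ((α : 𝕜) * θ i - f i Y) • e i‖ :=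
        hN₁ G (fun i hi => by
          obtain ⟨n, hn, rfl⟩ := hD i hi
          exact ⟨n, (le_max_left _ _).trans_lt hn, rfl⟩) _
    _ ≤ (M + ε) * (C * (Q * ‖x - y‖)) := by
      rw [← hvY]
      gcongr
      refine hle.trans ?_
      rw [hvz]
      gcongr
      exact (norm_add_le _ _).trans (by linarith)

/-- The main estimate. -/
lemma SemiGreedy.norm_sub_proj_le [CompleteSpace X] (hb : IsMarkushevichBasis e f)
    (hw : ∀ i, 0 < w i) {C s : ℝ} (hC : 0 < C) (hs0 : 0 < s) (hs1 : s ≤ 1)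
    (hsg : SemiGreedy e f w C s) {idx : ℕ → ℕ} (hidx : StrictMono idx) {c : ℝ} (hc : 0 < c)
    (hcw : ∀ k, c ≤ w (idx k)) {M : ℝ} (hfdsp : FDSP (𝕜 := 𝕜) (fun k => e (idx k)) M)
    {x : X} {m : ℕ} {t : ℝ} (ht0 : 0 < t) {A : Finset ℕ} (hA : GreedySet f x m t A) {y : X}
    (hy : wsum w (msupp f y) ≤ wsum w (A : Set ℕ)) (hdisj : Disjoint (msupp f y) (A : Set ℕ)) :
    ‖x - proj e f A x‖ ≤
      C * M * max (1 + 8 * t⁻¹ * s⁻¹ * ((⨆ i, ‖e i‖) * (⨆ i, ‖f i‖)))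
        (1 + 6 * C * t⁻¹ * s⁻¹ ^ 3) * ‖x - y‖ := by
  classical
  have hsum := hsg.hasSum_of_wsum_le hb hw hC hs0 hidx hc hcw hfdsp hy
  refine ge_of_tendsto' (((tendsto_const_nhds (x := x)).sub hsum).norm.const_mul _) fun T => ?_
  set B := T.filter fun i => f i y ≠ 0
  have hBy : (B : Set ℕ) ⊆ msupp f y := fun i hi => by
    exact (Finset.mem_filter.1 (Finset.mem_coe.1 hi)).2
  have hBT : ∑ i ∈ T, f i y • e i = ∑ i ∈ B, f i y • e i := by
    refine (Finset.sum_filter_of_ne fun i _ hi => ?_).symm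
    exact fun h => hi (by simp [h])
  rw [hBT]
  refine hsg.norm_sub_proj_le_of_msupp_subset hb hw hC hs0 hs1 hidx hc hcw hfdsp ht0 hA (B := B)
    (fun i hi => ?_) (sum_le_sum_of_wsum_le hw ((wsum_mono hBy).trans hy))
    (Finset.disjoint_coe.1 (hdisj.mono_left hBy))
  by_contra hiB
  exact hi (by rw [hb.coeff_sum B fun i => f i y, if_neg (by simpa using hiB)])

end SemiGreedyAux

/-- Theorem (w-semi-greedy ⇒ w-almost greedy, case of a weight subsequence
bounded below). -/
theorem statement0 {𝕜 : Type*} [RCLike 𝕜] {X : Type*} [NormedAddCommGroup X]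
    [NormedSpace 𝕜 X] [CompleteSpace X]
    (e : ℕ → X) (f : ℕ → X →L[𝕜] 𝕜) (hbasis : IsMarkushevichBasis e f)
    (w : ℕ → ℝ) (hw : ∀ i, 0 < w i)
    (C s : ℝ) (hC : 0 < C) (hs0 : 0 < s) (hs1 : s ≤ 1)
    (hsg : SemiGreedy e f w C s)
    (idx : ℕ → ℕ) (hidx : StrictMono idx)
    (c : ℝ) (hc : 0 < c) (hcw : ∀ k, c ≤ w (idx k))
    (M : ℝ) (hfdsp : FDSP (𝕜 := 𝕜) (fun k => e (idx k)) M) :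
    (∀ (x : X) (m : ℕ) (t : ℝ), 0 < t → t ≤ 1 → ∀ A : Finset ℕ, GreedySet f x m t A →
      ∀ y : X, wsum w (msupp f y) ≤ wsum w (A : Set ℕ) →
        Disjoint (msupp f y) (A : Set ℕ) →
        ‖x - proj e f A x‖ ≤
          C * M * max (1 + 8 * t⁻¹ * s⁻¹ * ((⨆ i, ‖e i‖) * (⨆ i, ‖f i‖)))
              (1 + 6 * C * t⁻¹ * s⁻¹ ^ 3) * ‖x - y‖) ∧
    AlmostGreedy e f w
      (C * M * max (1 + 8 * s⁻¹ * ((⨆ i, ‖e i‖) * (⨆ i, ‖f i‖))) (1 + 6 * C * s⁻¹ ^ 3)) := by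
  have hbound := fun (x : X) (m : ℕ) (t : ℝ) (ht0 : 0 < t) (A : Finset ℕ)
    (hA : GreedySet f x m t A) (y : X) => hsg.norm_sub_proj_le hbasis hw hC hs0 hs1 hidx hc hcw
      hfdsp ht0 hA (y := y)
  refine ⟨fun x m t ht0 _ A hA y => hbound x m t ht0 A hA y, fun x m A hA B hBA => ?_⟩
  set x' := x - proj e f (A ∩ B) x with hx'
  have hfx' : ∀ i, f i x' = if i ∈ A ∩ B then 0 else f i x := fun i => by
    rw [hx', map_sub, hbasis.coeff_proj]
    split_ifs <;> simp
  have hsplit : ∀ S T : Finset ℕ, S ∩ T = A ∩ B → proj e f (S \ T) x + proj e f (A ∩ B) x =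
      proj e f S x := fun S T h => by
    rw [← h, add_comm]
    exact Finset.sum_inter_add_sum_sdiff S T _
  have hgreedy : GreedySet f x' (A \ B).card 1 (A \ B) := by
    refine ⟨rfl, fun j hj k hk => ?_⟩
    rw [Finset.mem_sdiff] at hj hk
    rw [hfx', hfx', if_neg (fun h => hj.2 (Finset.mem_inter.1 h).2)]
    split_ifs with hkAB
    · simp
    · exact hA.2 j hj.1 k fun hkA => hk ⟨hkA, fun hkB => hkAB (Finset.mem_inter.2 ⟨hkA, hkB⟩)⟩
  have hproj : proj e f (A \ B) x' = proj e f (A \ B) x :=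
    Finset.sum_congr rfl fun i hi => by
      rw [hfx', if_neg fun h => (Finset.mem_sdiff.1 hi).2 (Finset.mem_inter.1 h).2]
  have hsupp : msupp f (proj e f (B \ A) x) ⊆ ((B \ A : Finset ℕ) : Set ℕ) := fun i hi => by
    by_contra hiB
    exact hi (by rw [hbasis.coeff_proj, if_neg (by simpa using hiB)])
  have hweight : ∑ i ∈ B \ A, w i ≤ ∑ i ∈ A \ B, w i := by
    have h1 := sum_le_sum_of_wsum_le hw hBA
    rw [← Finset.sum_inter_add_sum_sdiff A B, ← Finset.sum_inter_add_sum_sdiff B A,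
      Finset.inter_comm B A] at h1
    linarith
  have h := hbound x' _ 1 one_pos (A \ B) hgreedy (proj e f (B \ A) x)
    ((wsum_mono hsupp).trans (wsum_le_of_sum_le hw hweight))
    (Set.disjoint_of_subset_left hsupp (Finset.disjoint_coe.2 disjoint_sdiff_sdiff))
  rw [hproj, hx', sub_sub, add_comm, hsplit A B rfl, sub_sub, add_comm (proj e f (A ∩ B) x),
    hsplit B A (Finset.inter_comm B A)] at h
  simpa using h

end GreedyPaper
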